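/- Let f be a Feigenbaum map in the class U. Then there is a constant C_2 = C_2(f) > 0 such that |I_n| / |I_{n-1}| ≥ C_2 for all integers n ≥ 1, where |·| denotes the length of an interval. -/

import Mathlib

open Set MeasureTheory

/-- `Q_t(x) = -|x|^t`. -/
noncomputable def Qmap (t : ℝ) (x : ℝ) : ℝ := -(|x| ^ t)

/-- Nonlinearity `N(h) = h'' / (h')^2`. -/
noncomputable def Nonlin (h : ℝ → ℝ) (x : ℝ) : ℝ :=
  deriv (deriv h) x / (deriv h x) ^ 2

/-- Schwarzian derivative `S(h) = h'''/h' - (3/2)(h''/h')^2`. -/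
noncomputable def Schw (h : ℝ → ℝ) (x : ℝ) : ℝ :=
  deriv (deriv (deriv h)) x / deriv h x - 3 / 2 * (deriv (deriv h) x / deriv h x) ^ 2

/-- A unimodal map of `[-1,1]`: continuous, increasing on `[-1,0]`, decreasing
on `[0,1]`, even, fixing `-1` and sending `1` to `-1`. -/
def Unimodal (f : ℝ → ℝ) : Prop :=
  ContinuousOn f (Icc (-1) 1) ∧
  StrictMonoOn f (Icc (-1) 0) ∧
  StrictAntiOn f (Icc 0 1) ∧
  (∀ x ∈ Icc (-1 : ℝ) 1, f (-x) = f x) ∧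
  f (-1) = -1 ∧ f 1 = -1 ∧
  MapsTo f (Icc (-1) 1) (Icc (-1) 1)

/-- `h` is a `C³` diffeomorphism of `[-1,0]` onto its image (increasing, with
nonvanishing derivative) with nonpositive Schwarzian derivative. -/
def NegSchwDiffeo (h : ℝ → ℝ) : Prop :=
  ContDiffOn ℝ 3 h (Icc (-1) 0) ∧
  (∀ x ∈ Icc (-1 : ℝ) 0, 0 < deriv h x) ∧
  (∀ x ∈ Icc (-1 : ℝ) 0, Schw h x ≤ 0)

/-- The class `𝒰` of unimodal maps of the form `h ∘ Q_t`, `t > 1`, `h` a `C³`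
diffeomorphism with nonpositive Schwarzian derivative. -/
def InU (f : ℝ → ℝ) : Prop :=
  Unimodal f ∧
  ∃ t : ℝ, 1 < t ∧ ∃ h : ℝ → ℝ, NegSchwDiffeo h ∧
    ∀ x ∈ Icc (-1 : ℝ) 1, f x = h (Qmap t x)

/-- The period-doubling renormalization `α ∘ f² ∘ α⁻¹`, where `α` is the linear
map sending the fixed endpoint `q` of the restrictive interval to `-1`,
i.e. `α (x) = -x/q`. -/
noncomputable def Renorm2 (f : ℝ → ℝ) (q : ℝ) : ℝ → ℝ :=
  fun x => -(f^[2] (-q * x)) / q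

/-- `fs` is the sequence of successive period-doubling renormalizations of
`f = fs 0`: for each `k`, `fs k` is unimodal and renormalizable with return
time `2` via the symmetric interval `[-(|qs k|), |qs k|]`, whose endpoint
`qs k` is fixed by `(fs k)²`, and `fs (k+1)` is the rescaled return map. -/
def FeigSeq (f : ℝ → ℝ) (fs : ℕ → ℝ → ℝ) (qs : ℕ → ℝ) : Prop :=
  fs 0 = f ∧ ∀ k : ℕ,
    Unimodal (fs k) ∧
    0 < |qs k| ∧ |qs k| < 1 ∧
    (fs k)^[2] (qs k) = qs k ∧
    MapsTo ((fs k)^[2]) (Icc (-(|qs k|)) (|qs k|)) (Icc (-(|qs k|)) (|qs k|)) ∧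
    fs (k + 1) = Renorm2 (fs k) (qs k)

/-- A Feigenbaum map: every renormalization is defined and renormalizable with
return time `2`. -/
def Feigenbaum (f : ℝ → ℝ) : Prop := ∃ fs qs, FeigSeq f fs qs

/-- The periodic points `p 0 = -1`, `p 1 ∈ (0,1)` the fixed point of `f`, and
for `n ≥ 2`, `p n` the fixed point of `f^(2^(n-1))` lying strictly between
`-p (n-1)` and `0` or between `0` and `-p (n-1)`.  The interval `I n` is the
closed interval bounded by `p n` and `-p n`, of length `2 * |p n|`. -/
def FeigPoints (f : ℝ → ℝ) (p : ℕ → ℝ) : Prop :=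
  p 0 = -1 ∧ p 1 ∈ Ioo (0 : ℝ) 1 ∧ f (p 1) = p 1 ∧
  ∀ n : ℕ, 2 ≤ n →
    f^[2 ^ (n - 1)] (p n) = p n ∧ 0 < |p n| ∧ |p n| < |p (n - 1)|

/-- The intervals of the partition `η₀`: for an index `i = (s, n)` in
`ℤ ∪ {-0}` (encoded as `Bool × ℕ`, with `|i| = i.2`), `Jint p (true, n)` is the
right component `J n` of `I n \ I (n+1)` and `Jint p (false, n)` is the left
component `J (-n)`. -/
noncomputable def Jint (p : ℕ → ℝ) (i : Bool × ℕ) : Set ℝ :=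
  if i.1 = true then Ioc (|p (i.2 + 1)|) (|p i.2|)
  else Ico (-(|p i.2|)) (-(|p (i.2 + 1)|))

/-- A finite sequence of indices is admissible if consecutively the range of
each inverse branch is contained in the domain of the previous one, i.e.
`J (i_l) ⊆ F (J (i_(l-1))) = f^(2^(|i_(l-1)|)) (J (i_(l-1)))`. -/
def Admissible (f : ℝ → ℝ) (p : ℕ → ℝ) : List (Bool × ℕ) → Prop
  | [] => True
  | [_] => True
  | i :: j :: w => Jint p j ⊆ f^[2 ^ i.2] '' Jint p i ∧ Admissible f p (j :: w)

/-- `gbr i` is the inverse branch `(F|J i)⁻¹` of the induced Markov map `F`,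
where `F = f^(2^(|i|))` on `J i`. -/
def InvBranches (f : ℝ → ℝ) (p : ℕ → ℝ) (gbr : Bool × ℕ → ℝ → ℝ) : Prop :=
  ∀ i : Bool × ℕ,
    (∀ x ∈ Jint p i, gbr i (f^[2 ^ i.2] x) = x) ∧
    MapsTo (gbr i) (f^[2 ^ i.2] '' Jint p i) (Jint p i)

/-- The composed inverse branch `g_w = g_(i₀) ∘ g_(i₁) ∘ ⋯ ∘ g_(i_(k-1))`. -/
def gComp (gbr : Bool × ℕ → ℝ → ℝ) : List (Bool × ℕ) → ℝ → ℝ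
  | [] => id
  | i :: w => gbr i ∘ gComp gbr w

/-- The domain `D(g_w)` of the composed inverse branch: the domain
`F (J (i_(k-1)))` of the last branch. -/
noncomputable def DomG (f : ℝ → ℝ) (p : ℕ → ℝ) (w : List (Bool × ℕ)) : Set ℝ :=
  match w.getLast? with
  | none => ∅
  | some i => f^[2 ^ i.2] '' Jint p i

/-- The length of a set of reals. -/
noncomputable def len (S : Set ℝ) : ℝ := (volume S).toReal

/-- The induced Markov map has the bounded distortion property. -/
def BoundedDistortion (f : ℝ → ℝ) (p : ℕ → ℝ) (gbr : Bool × ℕ → ℝ → ℝ) : Prop :=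
  ∃ C > 0,
    (∀ n : ℕ, ∀ s : Bool,
      C ≤ len (Jint p (s, n)) / ∑' l : ℕ, len (Jint p (s, n + 1 + l))) ∧
    (∀ w : List (Bool × ℕ), w ≠ [] → Admissible f p w →
      ∀ x ∈ DomG f p w, |Nonlin (gComp gbr w) x| ≤ C / len (DomG f p w))

/-- `H` is quasisymmetric on `[-1,1]`. -/
def QuasiSymmetric (H : ℝ → ℝ) : Prop :=
  ∃ M > 0, ∀ x ∈ Icc (-1 : ℝ) 1, ∀ y ∈ Icc (-1 : ℝ) 1, x ≠ y →
    M⁻¹ ≤ |H x - H ((x + y) / 2)| / |H ((x + y) / 2) - H y| ∧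
    |H x - H ((x + y) / 2)| / |H ((x + y) / 2) - H y| ≤ M

/-- `H` is a homeomorphism of `[-1,1]` onto itself. -/
def IntervalHomeo (H : ℝ → ℝ) : Prop :=
  ContinuousOn H (Icc (-1) 1) ∧ BijOn H (Icc (-1) 1) (Icc (-1) 1)

/-- The strict cross-ratio inequality for the power map `x ↦ x ^ t` with `t > 1`. -/
theorem rpow_cross_lt {t a b : ℝ} (ht : 1 < t) (ha : 0 ≤ a) (hab : a < b) :
    t * a ^ (t - 1) * (t * b ^ (t - 1)) * (b - a) ^ 2 < (b ^ t - a ^ t) ^ 2 := by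
  have hb : 0 < b := ha.trans_lt hab
  rcases ha.eq_or_lt with rfl | ha
  · rw [Real.zero_rpow (by linarith), Real.zero_rpow (by linarith)]
    have := Real.rpow_pos_of_pos hb t
    have : 0 < (b ^ t) ^ 2 := by positivity
    simpa using this
  have key : ∀ s : ℝ, 1 < s → t * s ^ ((t - 1) / 2) * (s - 1) < s ^ t - 1 := by
    intro s hs
    have hmono : StrictMonoOn (fun x : ℝ => x ^ t - t * x ^ ((t - 1) / 2) * (x - 1)) (Ici 1) := by
      have hd : ∀ x : ℝ, 0 < x → HasDerivAt
          (fun x : ℝ => x ^ t - t * x ^ ((t - 1) / 2) * (x - 1))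
          (t * x ^ (t - 1) - (t * (((t - 1) / 2) * x ^ ((t - 1) / 2 - 1)) * (x - 1)
            + t * x ^ ((t - 1) / 2) * 1)) x := by
        intro x hx
        have h1 := Real.hasDerivAt_rpow_const (x := x) (p := t) (Or.inl hx.ne')
        have h2 := Real.hasDerivAt_rpow_const (x := x) (p := (t - 1) / 2) (Or.inl hx.ne')
        exact h1.sub ((h2.const_mul t).mul ((hasDerivAt_id x).sub_const 1))
      refine strictMonoOn_of_deriv_pos (convex_Ici 1)
        (fun x hx => (hd x (by linarith [mem_Ici.1 hx])).continuousAt.continuousWithinAt) ?_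
      intro x hx
      rw [interior_Ici] at hx
      have hx1 : 1 < x := hx
      have hx0 : 0 < x := by linarith
      rw [(hd x hx0).deriv]
      have hB := one_add_mul_self_lt_rpow_one_add (s := x - 1) (p := (t + 1) / 2)
        (by linarith) (by linarith) (by linarith)
      rw [add_sub_cancel] at hB
      have hw : 0 < x ^ ((t - 1) / 2 - 1) := Real.rpow_pos_of_pos hx0 _
      have e1 : x ^ (t - 1) = x ^ ((t - 1) / 2 - 1) * x ^ ((t + 1) / 2) := by
        rw [← Real.rpow_add hx0]; ring_nf
      have e2 : x ^ ((t - 1) / 2) = x ^ ((t - 1) / 2 - 1) * x := by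
        nth_rewrite 3 [← Real.rpow_one x]
        rw [← Real.rpow_add hx0]; ring_nf
      rw [e1, e2]
      have : 0 < t * x ^ ((t - 1) / 2 - 1) *
          (x ^ ((t + 1) / 2) - (1 + (t + 1) / 2 * (x - 1))) :=
        mul_pos (mul_pos (by linarith) hw) (by linarith)
      linarith [this]
    have := hmono (mem_Ici.2 le_rfl) (mem_Ici.2 hs.le) hs
    simp only [Real.one_rpow, sub_self, mul_zero, sub_zero] at this
    linarith
  obtain ⟨s, hs⟩ : ∃ s, s = b / a := ⟨_, rfl⟩
  have hs1 : 1 < s := by rw [hs, one_lt_div ha]; exact hab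
  have hs0 : 0 < s := by linarith
  have hbs : b = a * s := by rw [hs]; field_simp
  have hk := key s hs1
  have hl : 0 ≤ t * s ^ ((t - 1) / 2) * (s - 1) :=
    mul_nonneg (mul_nonneg (by linarith) (Real.rpow_nonneg hs0.le _)) (by linarith)
  have hsq := pow_lt_pow_left₀ hk hl two_ne_zero
  have e3 : (s ^ ((t - 1) / 2)) ^ 2 = s ^ (t - 1) := by
    rw [← Real.rpow_natCast, ← Real.rpow_mul hs0.le]; norm_num
  have e4 : a ^ t = a ^ (t - 1) * a := by
    nth_rewrite 3 [← Real.rpow_one a]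
    rw [← Real.rpow_add ha]; ring_nf
  have hat : 0 < (a ^ t) ^ 2 := by have := Real.rpow_pos_of_pos ha t; positivity
  rw [hbs, Real.mul_rpow ha.le hs0.le, Real.mul_rpow ha.le hs0.le]
  calc _ = (a ^ t) ^ 2 * (t * s ^ ((t - 1) / 2) * (s - 1)) ^ 2 := by
        rw [mul_pow, mul_pow, e3, e4]; ring
    _ < (a ^ t) ^ 2 * (s ^ t - 1) ^ 2 := mul_lt_mul_of_pos_left hsq hat
    _ = _ := by ring

/-- Nonpositive Schwarzian derivative implies the cross-ratio inequality. -/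
theorem NegSchwDiffeo.cross_le {h : ℝ → ℝ} (hh : NegSchwDiffeo h) {a b : ℝ}
    (ha : a ∈ Icc (-1 : ℝ) 0) (hb : b ∈ Icc (-1 : ℝ) 0) :
    deriv h a * deriv h b * (b - a) ^ 2 ≤ (h b - h a) ^ 2 := by
  obtain ⟨hC, hpos, hS⟩ := hh
  wlog hab : a < b generalizing a b
  · rcases (not_lt.1 hab).eq_or_lt with rfl | hlt
    · simp
    · have := this hb ha hlt
      nlinarith [this]
  have hdiff : ∀ x ∈ Icc (-1 : ℝ) 0, DifferentiableAt ℝ h x := fun x hx =>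
    differentiableAt_of_deriv_ne_zero (hpos x hx).ne'
  have hcont : ContinuousOn (deriv h) (Icc (-1) 0) := by
    refine (hC.continuousOn_derivWithin (uniqueDiffOn_Icc (by norm_num)) (by norm_num)).congr ?_
    intro x hx
    exact ((hdiff x hx).derivWithin (uniqueDiffOn_Icc (by norm_num) x hx)).symm
  have hCo : ContDiffOn ℝ 3 h (Ioo (-1) 0) := hC.mono Ioo_subset_Icc_self
  have hC1 : ContDiffOn ℝ 2 (deriv h) (Ioo (-1) 0) :=
    hCo.deriv_of_isOpen isOpen_Ioo (by norm_num)
  have hC2 : ContDiffOn ℝ 1 (deriv (deriv h)) (Ioo (-1) 0) :=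
    hC1.deriv_of_isOpen isOpen_Ioo (by norm_num)
  have d1 : ∀ x ∈ Ioo (-1 : ℝ) 0, HasDerivAt (deriv h) (deriv (deriv h) x) x := fun x hx =>
    ((hC1.contDiffAt (isOpen_Ioo.mem_nhds hx)).differentiableAt (by norm_num)).hasDerivAt
  have d2 : ∀ x ∈ Ioo (-1 : ℝ) 0,
      HasDerivAt (deriv (deriv h)) (deriv (deriv (deriv h)) x) x := fun x hx =>
    ((hC2.contDiffAt (isOpen_Ioo.mem_nhds hx)).differentiableAt (by norm_num)).hasDerivAt
  set φ : ℝ → ℝ := fun x => deriv h x ^ (-(1 / 2) : ℝ) with hφ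
  have φ1 : ∀ x ∈ Ioo (-1 : ℝ) 0, HasDerivAt φ
      (deriv (deriv h) x * (-(1 / 2)) * deriv h x ^ (-(1 / 2) - 1 : ℝ)) x := fun x hx =>
    (d1 x hx).rpow_const (Or.inl (hpos x (Ioo_subset_Icc_self hx)).ne')
  have φ2 : ∀ x ∈ Ioo (-1 : ℝ) 0, HasDerivAt
      (fun x => deriv (deriv h) x * (-(1 / 2)) * deriv h x ^ (-(1 / 2) - 1 : ℝ))
      (deriv (deriv (deriv h)) x * (-(1 / 2)) * deriv h x ^ (-(1 / 2) - 1 : ℝ) +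
        deriv (deriv h) x * (-(1 / 2)) *
          (deriv (deriv h) x * (-(1 / 2) - 1) * deriv h x ^ (-(1 / 2) - 1 - 1 : ℝ))) x :=
    fun x hx => ((d2 x hx).mul_const _).mul
      ((d1 x hx).rpow_const (Or.inl (hpos x (Ioo_subset_Icc_self hx)).ne'))
  have hφpos : ∀ x ∈ Icc (-1 : ℝ) 0, 0 < φ x := fun x hx => Real.rpow_pos_of_pos (hpos x hx) _
  have hφsq : ∀ x ∈ Icc (-1 : ℝ) 0, deriv h x * φ x ^ 2 = 1 := by
    intro x hx
    have h0 := hpos x hx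
    have : φ x ^ 2 = (deriv h x)⁻¹ := by
      rw [hφ, ← Real.rpow_natCast, ← Real.rpow_mul h0.le, ← Real.rpow_neg_one]; norm_num
    rw [this, mul_inv_cancel₀ h0.ne']
  have hconv : ConvexOn ℝ (Icc (-1) 0) φ := by
    refine convexOn_of_hasDerivWithinAt2_nonneg (convex_Icc _ _)
      (hcont.rpow_const fun x hx => Or.inl (hpos x hx).ne')
      (f' := fun x => deriv (deriv h) x * (-(1 / 2)) * deriv h x ^ (-(1 / 2) - 1 : ℝ))
      (f'' := fun x => deriv (deriv (deriv h)) x * (-(1 / 2)) * deriv h x ^ (-(1 / 2) - 1 : ℝ) +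
        deriv (deriv h) x * (-(1 / 2)) *
          (deriv (deriv h) x * (-(1 / 2) - 1) * deriv h x ^ (-(1 / 2) - 1 - 1 : ℝ))) ?_ ?_ ?_
    · intro x hx
      rw [interior_Icc] at hx
      exact (φ1 x hx).hasDerivWithinAt
    · intro x hx
      rw [interior_Icc] at hx
      exact (φ2 x hx).hasDerivWithinAt
    · intro x hx
      rw [interior_Icc] at hx
      have h0 := hpos x (Ioo_subset_Icc_self hx)
      have hs := hS x (Ioo_subset_Icc_self hx)
      have hw : 0 < deriv h x ^ (-(1 / 2) : ℝ) := Real.rpow_pos_of_pos h0 _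
      rw [Real.rpow_sub_one h0.ne' (-(1 / 2) - 1), Real.rpow_sub_one h0.ne']
      have e : deriv (deriv (deriv h)) x * (-(1 / 2)) * (deriv h x ^ (-(1 / 2) : ℝ) / deriv h x) +
          deriv (deriv h) x * (-(1 / 2)) * (deriv (deriv h) x * (-(1 / 2) - 1) *
            (deriv h x ^ (-(1 / 2) : ℝ) / deriv h x / deriv h x)) =
          1 / 2 * deriv h x ^ (-(1 / 2) : ℝ) * (-Schw h x) := by
        rw [Schw]; field_simp; ring
      rw [e]
      exact mul_nonneg (by positivity) (by linarith)
  set m : ℝ := (φ b - φ a) / (b - a) with hm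
  set l : ℝ → ℝ := fun x => φ a + m * (x - a) with hl
  have hba : 0 < b - a := by linarith
  have hla : l a = φ a := by simp [hl]
  have hlb : l b = φ b := by rw [hl, hm]; field_simp; ring
  have hsub : Icc a b ⊆ Icc (-1 : ℝ) 0 := Icc_subset_Icc ha.1 hb.2
  have hφl : ∀ x ∈ Icc a b, φ x ≤ l x := by
    intro x hx
    have h1 : 0 ≤ (b - x) / (b - a) := div_nonneg (by linarith [hx.2]) hba.le
    have h2 : 0 ≤ (x - a) / (b - a) := div_nonneg (by linarith [hx.1]) hba.le
    have h3 : (b - x) / (b - a) + (x - a) / (b - a) = 1 := by field_simp; ring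
    have := hconv.2 ha hb h1 h2 h3
    simp only [smul_eq_mul] at this
    have e1 : (b - x) / (b - a) * a + (x - a) / (b - a) * b = x := by field_simp; ring
    have e2 : (b - x) / (b - a) * φ a + (x - a) / (b - a) * φ b = l x := by
      rw [hl, hm]; field_simp; ring
    rwa [e1, e2] at this
  have hlpos : ∀ x ∈ Icc a b, 0 < l x := fun x hx => (hφpos x (hsub hx)).trans_le (hφl x hx)
  have hφa := hφpos a ha
  have hφb := hφpos b hb
  have hlderiv : ∀ x, HasDerivAt l m x := fun x =>
    ((((hasDerivAt_id x).sub_const a).const_mul m).const_add (φ a)).congr_deriv (mul_one m)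
  have hHd : ∀ x ∈ Icc a b, HasDerivAt (fun x => h x - (x - a) / (φ a * l x))
      (deriv h x - (1 * (φ a * l x) - (x - a) * (φ a * m)) / (φ a * l x) ^ 2) x := by
    intro x hx
    exact (hdiff x (hsub hx)).hasDerivAt.sub
      (((hasDerivAt_id x).sub_const a).div ((hlderiv x).const_mul (φ a))
        (mul_pos hφa (hlpos x hx)).ne')
  have hmono : MonotoneOn (fun x => h x - (x - a) / (φ a * l x)) (Icc a b) := by
    refine monotoneOn_of_deriv_nonneg (convex_Icc a b)
      (fun x hx => (hHd x hx).continuousAt.continuousWithinAt)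
      (fun x hx => (hHd x (interior_subset hx)).differentiableAt.differentiableWithinAt) ?_
    intro x hx
    have hx := interior_subset hx
    rw [(hHd x hx).deriv]
    have hlx := hlpos x hx
    have e : (1 * (φ a * l x) - (x - a) * (φ a * m)) / (φ a * l x) ^ 2 = 1 / l x ^ 2 := by
      have : 1 * (φ a * l x) - (x - a) * (φ a * m) = φ a ^ 2 := by rw [hl]; ring
      rw [this]; field_simp
    rw [e, sub_nonneg, div_le_iff₀ (by positivity), ← hφsq x (hsub hx)]
    exact mul_le_mul_of_nonneg_left
      (pow_le_pow_left₀ (hφpos x (hsub hx)).le (hφl x hx) 2) (hpos x (hsub hx)).le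
  have hfin := hmono (left_mem_Icc.2 hab.le) (right_mem_Icc.2 hab.le) hab.le
  simp only [sub_self, zero_div, sub_zero, hlb] at hfin
  have h1 : (b - a) / (φ a * φ b) ≤ h b - h a := by linarith
  have h2 := pow_le_pow_left₀ (by positivity) h1 2
  refine le_of_eq_of_le ?_ h2
  have ea := hφsq a ha
  have eb := hφsq b hb
  rw [div_pow, eq_div_iff (by positivity)]
  calc deriv h a * deriv h b * (b - a) ^ 2 * (φ a * φ b) ^ 2
      = (deriv h a * φ a ^ 2) * (deriv h b * φ b ^ 2) * (b - a) ^ 2 := by ring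
    _ = (b - a) ^ 2 := by rw [ea, eb]; ring

/-- If `G` starts strictly below the diagonal and reaches it, then at its first fixed point the
derivative is at least one. -/
theorem exists_first_fixedPoint {G D : ℝ → ℝ} {a b : ℝ} (hab : a ≤ b)
    (hd : ∀ x ∈ Icc a b, HasDerivWithinAt G (D x) (Icc a b) x) (ha : G a < a) (hb : G b = b) :
    ∃ m ∈ Ioc a b, G m = m ∧ 1 ≤ D m ∧ ∀ x ∈ Ico a m, G x < x := by
  have hc : ContinuousOn G (Icc a b) := fun x hx => (hd x hx).continuousWithinAt
  have hcl : IsCompact {x ∈ Icc a b | G x - x = 0} :=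
    isCompact_Icc.of_isClosed_subset
      ((hc.sub continuousOn_id).preimage_isClosed_of_isClosed isClosed_Icc isClosed_singleton)
      (fun x hx => hx.1)
  obtain ⟨m, ⟨hm, hm0⟩, hleast⟩ := hcl.exists_isLeast ⟨b, right_mem_Icc.2 hab, by linarith⟩
  have hGm : G m = m := by linarith
  have ham : a < m := lt_of_le_of_ne hm.1 (by rintro rfl; linarith)
  have hlt : ∀ x ∈ Ico a m, G x < x := by
    intro x hx
    by_contra! hge
    obtain ⟨y, hy, hy0⟩ := intermediate_value_Icc hx.1
      ((hc.sub continuousOn_id).mono (Icc_subset_Icc_right (hx.2.le.trans hm.2)))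
      (show (0 : ℝ) ∈ Icc (G a - a) (G x - x) from ⟨by linarith, by linarith⟩)
    have := hleast (show y ∈ {x ∈ Icc a b | G x - x = 0} from
      ⟨⟨hy.1, hy.2.trans (hx.2.le.trans hm.2)⟩, hy0⟩)
    linarith [hy.2, hx.2]
  refine ⟨m, ⟨ham, hm.2⟩, hGm, ?_, hlt⟩
  have h1 := (hd m hm).mono
    (Ico_subset_Icc_self.trans (Icc_subset_Icc_right hm.2) : Ico a m ⊆ Icc a b)
  rw [hasDerivWithinAt_iff_tendsto_slope' (by simp)] at h1
  have : (nhdsWithin m (Ico a m)).NeBot :=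
    mem_closure_iff_nhdsWithin_neBot.1 (by
      rw [closure_Ico ham.ne]; exact right_mem_Icc.2 ham.le)
  refine ge_of_tendsto h1 ?_
  filter_upwards [self_mem_nhdsWithin] with x hx
  rw [slope_def_field, hGm, le_div_iff_of_neg (by linarith [hx.2])]
  linarith [hlt x hx]

/-- Between two fixed points there is one, possibly an endpoint, with derivative at least one. -/
theorem exists_fixedPoint_one_le_deriv {G D : ℝ → ℝ} {a b : ℝ} (hab : a < b)
    (hd : ∀ x ∈ Icc a b, HasDerivWithinAt G (D x) (Icc a b) x) (ha : G a = a) (hb : G b = b) :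
    ∃ m ∈ Icc a b, G m = m ∧ 1 ≤ D m := by
  by_cases hD : 1 ≤ D a
  · exact ⟨a, left_mem_Icc.2 hab.le, ha, hD⟩
  push Not at hD
  have h1 := (hd a (left_mem_Icc.2 hab.le)).mono (Ioc_subset_Icc_self : Ioc a b ⊆ Icc a b)
  rw [hasDerivWithinAt_iff_tendsto_slope' (by simp)] at h1
  have : (nhdsWithin a (Ioc a b)).NeBot :=
    mem_closure_iff_nhdsWithin_neBot.1 (by
      rw [closure_Ioc hab.ne]; exact left_mem_Icc.2 hab.le)
  obtain ⟨x, hx, hxab⟩ := ((h1.eventually (gt_mem_nhds hD)).and self_mem_nhdsWithin).exists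
  rw [slope_def_field, ha, div_lt_one (by linarith [hxab.1])] at hx
  obtain ⟨m, hm, hm1, hm2, -⟩ := exists_first_fixedPoint hxab.2
    (fun y hy => (hd y ⟨hxab.1.le.trans hy.1, hy.2⟩).mono (Icc_subset_Icc_left hxab.1.le))
    (show G x < x by linarith) hb
  exact ⟨m, ⟨hxab.1.le.trans hm.1.le, hm.2⟩, hm1, hm2⟩

/-- `f` is a unimodal map `h ∘ Q_t`, where `h` has derivative `h' ≥ 0` and satisfies the
cross-ratio inequality that follows from a nonpositive Schwarzian derivative. -/
structure CrossRatioUnimodal (t : ℝ) (f h h' : ℝ → ℝ) : Prop where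
  one_lt : 1 < t
  unimodal : Unimodal f
  eq_comp : ∀ x ∈ Icc (-1 : ℝ) 1, f x = h (Qmap t x)
  hasDeriv : ∀ y ∈ Icc (-1 : ℝ) 0, HasDerivWithinAt h (h' y) (Icc (-1) 0) y
  nonneg : ∀ y ∈ Icc (-1 : ℝ) 0, 0 ≤ h' y
  cross_le : ∀ a ∈ Icc (-1 : ℝ) 0, ∀ b ∈ Icc (-1 : ℝ) 0,
    h' a * h' b * (b - a) ^ 2 ≤ (h b - h a) ^ 2

/-- The derivative on `[0,1]` of the map `h ∘ Q_t`. -/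
noncomputable def powDeriv (t : ℝ) (h' : ℝ → ℝ) (x : ℝ) : ℝ :=
  -(h' (-(x ^ t)) * (t * x ^ (t - 1)))

theorem InU.exists_crossRatioUnimodal {f : ℝ → ℝ} (hf : InU f) :
    ∃ t h h', CrossRatioUnimodal t f h h' := by
  obtain ⟨hu, t, ht, h, hh, hfh⟩ := hf
  exact ⟨t, h, deriv h, ht, hu, hfh,
    fun y hy => (differentiableAt_of_deriv_ne_zero (hh.2.1 y hy).ne').hasDerivAt.hasDerivWithinAt,
    fun y hy => (hh.2.1 y hy).le, fun a ha b hb => hh.cross_le ha hb⟩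

theorem neg_rpow_mem {t x : ℝ} (ht : 1 < t) (hx : x ∈ Icc (0 : ℝ) 1) :
    -(x ^ t) ∈ Icc (-1 : ℝ) 0 :=
  ⟨by linarith [Real.rpow_le_one hx.1 hx.2 (by linarith : (0 : ℝ) ≤ t)],
    by linarith [Real.rpow_nonneg hx.1 t]⟩

namespace CrossRatioUnimodal

variable {t : ℝ} {f h h' : ℝ → ℝ}

theorem eq_of_nonneg (H : CrossRatioUnimodal t f h h') {x : ℝ} (hx : x ∈ Icc (0 : ℝ) 1) :
    f x = h (-(x ^ t)) := by
  rw [H.eq_comp x ⟨by linarith [hx.1], hx.2⟩, Qmap, abs_of_nonneg hx.1]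

theorem hasDerivWithinAt (H : CrossRatioUnimodal t f h h') {x : ℝ} (hx : x ∈ Icc (0 : ℝ) 1) :
    HasDerivWithinAt f (powDeriv t h' x) (Icc 0 1) x := by
  have ht := H.one_lt
  have h1 : HasDerivWithinAt (fun x : ℝ => -(x ^ t)) (-(t * x ^ (t - 1))) (Icc 0 1) x :=
    (Real.hasDerivAt_rpow_const (Or.inr ht.le)).hasDerivWithinAt.neg
  have h2 := (H.hasDeriv _ (neg_rpow_mem ht hx)).comp x h1 (fun y hy => neg_rpow_mem ht hy)
  rw [powDeriv, ← mul_neg]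
  exact h2.congr (fun y hy => H.eq_of_nonneg hy) (H.eq_of_nonneg hx)

theorem powDeriv_nonpos (H : CrossRatioUnimodal t f h h') {x : ℝ} (hx : x ∈ Icc (0 : ℝ) 1) :
    powDeriv t h' x ≤ 0 := by
  have ht := H.one_lt
  rw [powDeriv, neg_nonpos]
  exact mul_nonneg (H.nonneg _ (neg_rpow_mem ht hx))
    (mul_nonneg (by linarith) (Real.rpow_nonneg hx.1 _))

theorem powDeriv_cross_lt (H : CrossRatioUnimodal t f h h') {a b : ℝ} (ha : a ∈ Icc (0 : ℝ) 1)
    (hb : b ∈ Icc (0 : ℝ) 1) (hab : a ≠ b) :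
    powDeriv t h' a * powDeriv t h' b * (b - a) ^ 2 < (f b - f a) ^ 2 := by
  have ht := H.one_lt
  wlog hlt : a < b generalizing a b
  · have := this hb ha hab.symm (lt_of_le_of_ne (not_lt.1 hlt) hab.symm)
    nlinarith [this]
  have hA := neg_rpow_mem ht ha
  have hB := neg_rpow_mem ht hb
  have hf := H.unimodal.2.2.1 ha hb hlt
  have hpos : 0 < (f b - f a) ^ 2 := by have : f b - f a ≠ 0 := by linarith
                                        positivity
  have hc := H.cross_le _ hA _ hB
  rw [← H.eq_of_nonneg ha, ← H.eq_of_nonneg hb] at hc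
  have e : powDeriv t h' a * powDeriv t h' b * (b - a) ^ 2 =
      h' (-(a ^ t)) * h' (-(b ^ t)) *
        (t * a ^ (t - 1) * (t * b ^ (t - 1)) * (b - a) ^ 2) := by
    rw [powDeriv, powDeriv]; ring
  rw [e]
  rcases (mul_nonneg (H.nonneg _ hA) (H.nonneg _ hB)).eq_or_lt with h0 | h0
  · rw [← h0, zero_mul]; exact hpos
  · refine (mul_lt_mul_of_pos_left (rpow_cross_lt ht ha.1 hlt) h0).trans_le ?_
    calc _ = h' (-(a ^ t)) * h' (-(b ^ t)) * (-(b ^ t) - -(a ^ t)) ^ 2 := by ring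
      _ ≤ _ := hc

theorem renorm2 (H : CrossRatioUnimodal t f h h') {q : ℝ} (hq : q ∈ Ioo (0 : ℝ) 1)
    (hfq : 0 ≤ f q) (hR : Unimodal (Renorm2 f q)) :
    ∃ k k', CrossRatioUnimodal t (Renorm2 f q) k k' := by
  have ht := H.one_lt
  have ht0 : 0 < t := by linarith
  have hqt : q ^ t ∈ Ioc (0 : ℝ) 1 :=
    ⟨Real.rpow_pos_of_pos hq.1 _, Real.rpow_le_one hq.1.le hq.2.le ht0.le⟩
  have hin : ∀ y ∈ Icc (-1 : ℝ) 0, q ^ t * y ∈ Icc (-1 : ℝ) 0 := fun y hy =>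
    ⟨by nlinarith [hqt.1, hqt.2, hy.1, hy.2], by nlinarith [hqt.1, hy.2]⟩
  have hmid : ∀ y ∈ Icc (-1 : ℝ) 0, h (q ^ t * y) ∈ Icc (0 : ℝ) 1 := by
    intro y hy
    have hy0 : 0 ≤ -y := by linarith [hy.2]
    set x := (-y) ^ (1 / t) with hx
    have hx0 : 0 ≤ x := Real.rpow_nonneg hy0 _
    have hx1 : x ≤ 1 := Real.rpow_le_one hy0 (by linarith [hy.1]) (by positivity)
    have hxt : x ^ t = -y := by
      rw [hx, ← Real.rpow_mul hy0, one_div_mul_cancel ht0.ne', Real.rpow_one]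
    have hqx : q * x ≤ q := mul_le_of_le_one_right hq.1.le hx1
    have hqx0 : 0 ≤ q * x := mul_nonneg hq.1.le hx0
    have hmem : q * x ∈ Icc (0 : ℝ) 1 := ⟨hqx0, hqx.trans hq.2.le⟩
    have e : h (q ^ t * y) = f (q * x) := by
      rw [H.eq_of_nonneg hmem, Real.mul_rpow hq.1.le hx0, hxt]; ring_nf
    rw [e]
    exact ⟨hfq.trans (H.unimodal.2.2.1.antitoneOn hmem ⟨hq.1.le, hq.2.le⟩ hqx),
      (H.unimodal.2.2.2.2.2.2 ⟨by linarith, hmem.2⟩).2⟩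
  have hq0 := hq.1
  refine ⟨fun y => -(f (h (q ^ t * y))) / q,
    fun y => -(powDeriv t h' (h (q ^ t * y)) * (h' (q ^ t * y) * (q ^ t))) / q,
    ht, hR, ?_, ?_, ?_, ?_⟩
  · intro x hx
    have : f (-q * x) = h (q ^ t * Qmap t x) := by
      have hm : -q * x ∈ Icc (-1 : ℝ) 1 :=
        ⟨by nlinarith [hx.1, hx.2, hq.1, hq.2], by nlinarith [hx.1, hx.2, hq.1, hq.2]⟩
      rw [H.eq_comp _ hm, Qmap, Qmap, abs_mul, abs_neg, abs_of_pos hq.1,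
        Real.mul_rpow hq.1.le (abs_nonneg _)]
      ring_nf
    simp only [Renorm2, Function.iterate_succ, Function.iterate_zero, Function.comp_apply, id, this]
  · intro y hy
    have h1 : HasDerivWithinAt (fun y : ℝ => q ^ t * y) (q ^ t) (Icc (-1) 0) y := by
      simpa using ((hasDerivAt_id y).const_mul (q ^ t)).hasDerivWithinAt
    have h2 := (H.hasDeriv _ (hin y hy)).comp y h1 hin
    have h3 := (H.hasDerivWithinAt (hmid y hy)).comp y h2 hmid
    exact h3.neg.div_const q
  · intro y hy
    refine div_nonneg (neg_nonneg.2 (mul_nonpos_of_nonpos_of_nonneg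
      (H.powDeriv_nonpos (hmid y hy)) (mul_nonneg (H.nonneg _ (hin y hy)) hqt.1.le))) hq.1.le
  · intro a ha b hb
    have hA := hmid a ha
    have hB := hmid b hb
    set u := h (q ^ t * a)
    set v := h (q ^ t * b)
    have c1 := H.cross_le _ (hin a ha) _ (hin b hb)
    have hpp := mul_nonneg_of_nonpos_of_nonpos (H.powDeriv_nonpos hA) (H.powDeriv_nonpos hB)
    have c2 : powDeriv t h' u * powDeriv t h' v * (v - u) ^ 2 ≤ (f v - f u) ^ 2 := by
      by_cases huv : u = v
      · simp [huv]
      · exact (H.powDeriv_cross_lt hA hB huv).le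
    have c3 := mul_le_mul_of_nonneg_left c1 hpp
    have e : ∀ x y z w : ℝ, -(x * (y * q ^ t)) / q * (-(z * (w * q ^ t)) / q) * (b - a) ^ 2 =
        x * z * (y * w * (q ^ t * b - q ^ t * a) ^ 2) / q ^ 2 := by
      intro x y z w; field_simp
    have e' : (-f v / q - -f u / q) ^ 2 = (f v - f u) ^ 2 / q ^ 2 := by
      field_simp; ring
    rw [e, e']
    gcongr
    exact c3.trans c2

end CrossRatioUnimodal

theorem renorm2_apply (f : ℝ → ℝ) (q x : ℝ) : Renorm2 f q x = -(f (f (-q * x))) / q := rfl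

namespace CrossRatioUnimodal

variable {t : ℝ} {f h h' : ℝ → ℝ}

theorem hasDerivWithinAt_left (H : CrossRatioUnimodal t f h h') {x : ℝ}
    (hx : x ∈ Icc (-1 : ℝ) 0) :
    HasDerivWithinAt f (-powDeriv t h' (-x)) (Icc (-1) 0) x := by
  have hmap : MapsTo (fun y : ℝ => -y) (Icc (-1) 0) (Icc 0 1) := fun y hy =>
    ⟨by linarith [hy.2], by linarith [hy.1]⟩
  have h1 := (H.hasDerivWithinAt (hmap hx)).comp x (hasDerivWithinAt_id x _).neg hmap
  have hev : ∀ y ∈ Icc (-1 : ℝ) 0, f y = f (-y) := fun y hy =>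
    (H.unimodal.2.2.2.1 y ⟨hy.1, by linarith [hy.2]⟩).symm
  simpa using h1.congr hev (hev x hx)

theorem not_four_fixedPoints_left (H : CrossRatioUnimodal t f h h') {a b c d : ℝ}
    (ha : -1 ≤ a) (hab : a < b) (hbc : b < c) (hcd : c < d) (hd : d ≤ 0)
    (fa : f a = a) (fb : f b = b) (fc : f c = c) (fd : f d = d) : False := by
  have hderiv : ∀ u v, -1 ≤ u → v ≤ 0 → ∀ x ∈ Icc u v,
      HasDerivWithinAt f (-powDeriv t h' (-x)) (Icc u v) x := fun u v hu hv x hx =>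
    (H.hasDerivWithinAt_left ⟨hu.trans hx.1, hx.2.trans hv⟩).mono (Icc_subset_Icc hu hv)
  obtain ⟨m, hm, fm, Dm⟩ := exists_fixedPoint_one_le_deriv hab
    (hderiv a b ha (by linarith)) fa fb
  obtain ⟨n, hn, fn, Dn⟩ := exists_fixedPoint_one_le_deriv hcd
    (hderiv c d (by linarith) hd) fc fd
  have hmI : m ∈ Icc (-1 : ℝ) 0 := ⟨by linarith [hm.1], by linarith [hm.2]⟩
  have hnI : n ∈ Icc (-1 : ℝ) 0 := ⟨by linarith [hn.1], by linarith [hn.2]⟩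
  have hmn : m < n := by linarith [hm.2, hn.1]
  have hc := H.powDeriv_cross_lt (a := -m) (b := -n) ⟨by linarith [hmI.2], by linarith [hmI.1]⟩
    ⟨by linarith [hnI.2], by linarith [hnI.1]⟩ (by intro h; linarith)
  rw [H.unimodal.2.2.2.1 m ⟨hmI.1, by linarith [hmI.2]⟩,
    H.unimodal.2.2.2.1 n ⟨hnI.1, by linarith [hnI.2]⟩, fm, fn] at hc
  have h1 : 1 ≤ powDeriv t h' (-m) * powDeriv t h' (-n) := by nlinarith
  have h2 : 0 < (n - m) ^ 2 := by have : n - m ≠ 0 := by linarith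
                                  positivity
  nlinarith

end CrossRatioUnimodal

namespace Unimodal

variable {f : ℝ → ℝ} {q : ℝ}

theorem le_apply_zero (hf : Unimodal f) {x : ℝ} (hx : x ∈ Icc (-1 : ℝ) 1) : f x ≤ f 0 := by
  rcases le_total x 0 with h | h
  · exact hf.2.1.monotoneOn ⟨hx.1, h⟩ ⟨by norm_num, le_rfl⟩ h
  · exact hf.2.2.1.antitoneOn ⟨le_rfl, by norm_num⟩ ⟨h, hx.2⟩ h

theorem apply_neg (hf : Unimodal f) {x : ℝ} (hx : x ∈ Icc (-1 : ℝ) 1) : f (-x) = f x :=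
  hf.2.2.2.1 x hx

theorem apply_zero_le_one (hf : Unimodal f) : f 0 ≤ 1 :=
  (hf.2.2.2.2.2.2 ⟨by norm_num, by norm_num⟩).2

theorem neg_one_le (hf : Unimodal f) {x : ℝ} (hx : x ∈ Icc (-1 : ℝ) 1) : -1 ≤ f x :=
  (hf.2.2.2.2.2.2 hx).1

theorem pos_of_apply_zero_pos (hf : Unimodal f) (hq0 : q ≠ 0) (hq1 : |q| < 1)
    (hR : Unimodal (Renorm2 f q)) (h0 : 0 < f 0) : 0 < q := by
  by_contra! hq
  have hq : q < 0 := lt_of_le_of_ne hq hq0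
  rw [abs_of_neg hq] at hq1
  obtain ⟨y, hy, hy0⟩ : ∃ y ∈ Ico q 0, 0 ≤ f y := by
    by_cases hfq : 0 ≤ f q
    · exact ⟨q, ⟨le_rfl, hq⟩, hfq⟩
    · obtain ⟨y, hy, hy0⟩ := intermediate_value_Icc hq.le
        (hf.1.mono (Icc_subset_Icc (by linarith) (by norm_num)))
        (show (0 : ℝ) ∈ Icc (f q) (f 0) from ⟨by linarith, h0.le⟩)
      refine ⟨y, ⟨hy.1, lt_of_le_of_ne hy.2 ?_⟩, hy0.ge⟩
      rintro rfl
      linarith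
  have hlt : f y < f 0 := hf.2.1 ⟨by linarith [hy.1], hy.2.le⟩ ⟨by norm_num, le_rfl⟩ hy.2
  have h1 := hf.2.2.1 ⟨hy0, hlt.le.trans hf.apply_zero_le_one⟩ ⟨h0.le, hf.apply_zero_le_one⟩ hlt
  have h2 : -1 ≤ -y / q := by rw [le_div_iff_of_neg hq]; linarith [hy.1]
  have h3 : -y / q < 0 := div_neg_of_pos_of_neg (by linarith [hy.2]) hq
  have h4 := hR.2.1 ⟨h2, h3.le⟩ ⟨by norm_num, le_rfl⟩ h3
  rw [renorm2_apply, renorm2_apply, mul_zero,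
    show -q * (-y / q) = y by field_simp, div_lt_div_right_of_neg hq] at h4
  linarith

theorem apply_nonneg_of_pos (hf : Unimodal f) (hq : q ∈ Ioo (0 : ℝ) 1)
    (hR : Unimodal (Renorm2 f q)) (h0 : 0 < f 0) : 0 ≤ f q := by
  by_contra! hfq
  have hq0 := hq.1
  obtain ⟨y, hy, hy0⟩ := intermediate_value_Icc' hq.1.le
    (hf.1.mono (Icc_subset_Icc (by norm_num) hq.2.le))
    (show (0 : ℝ) ∈ Icc (f q) (f 0) from ⟨hfq.le, h0.le⟩)
  have hyq : y < q := lt_of_le_of_ne hy.2 (by rintro rfl; linarith)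
  have h3 : y / q < 1 := (div_lt_one hq.1).2 hyq
  have h4 := hR.2.2.1 ⟨div_nonneg hy.1 hq.1.le, h3.le⟩ ⟨by norm_num, le_rfl⟩ h3
  rw [renorm2_apply, renorm2_apply, mul_one, show -q * (y / q) = -y by field_simp,
    hf.apply_neg ⟨by linarith [hq.1], hq.2.le⟩,
    hf.apply_neg ⟨by linarith [hy.1], by linarith [hq.2]⟩,
    hy0, div_lt_div_iff_of_pos_right hq.1] at h4
  have := hf.le_apply_zero (x := f q) ⟨hf.neg_one_le ⟨by linarith, hq.2.le⟩, by linarith⟩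
  linarith

theorem neg_of_apply_zero_nonpos (hf : Unimodal f) (hq0 : q ≠ 0) (hq1 : |q| < 1)
    (hR : Unimodal (Renorm2 f q)) (h0 : f 0 ≤ 0) : q < 0 := by
  by_contra! hq
  have hq : 0 < q := lt_of_le_of_ne hq hq0.symm
  rw [abs_of_pos hq] at hq1
  have h4 := hR.2.2.1 ⟨le_rfl, zero_le_one⟩ ⟨zero_le_one, le_rfl⟩ (zero_lt_one (α := ℝ))
  rw [renorm2_apply, renorm2_apply, mul_one, mul_zero,
    hf.apply_neg ⟨by linarith, hq1.le⟩, div_lt_div_iff_of_pos_right hq] at h4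
  have h5 := hf.2.2.1 ⟨le_rfl, by norm_num⟩ ⟨hq.le, hq1.le⟩ hq
  have h6 := hf.2.1 ⟨hf.neg_one_le ⟨by linarith, hq1.le⟩, by linarith⟩
    ⟨hf.neg_one_le ⟨by norm_num, by norm_num⟩, h0⟩ h5
  linarith

theorem fixed_of_iterate_two_fixed (hf : Unimodal f) (h0 : f 0 ≤ 0) {u : ℝ}
    (hu : u ∈ Icc (-1 : ℝ) 0) (hfu : f (f u) = u) : f u = u := by
  have hu' : u ∈ Icc (-1 : ℝ) 1 := ⟨hu.1, by linarith [hu.2]⟩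
  have hm : f u ∈ Icc (-1 : ℝ) 0 := ⟨hf.neg_one_le hu', (hf.le_apply_zero hu').trans h0⟩
  rcases lt_trichotomy (f u) u with h | h | h
  · linarith [hf.2.1 hm hu h]
  · exact h
  · linarith [hf.2.1 hu hm h]

end Unimodal

theorem FeigSeq.apply_zero_nonpos_step {f : ℝ → ℝ} {fs : ℕ → ℝ → ℝ} {qs : ℕ → ℝ}
    (hs : FeigSeq f fs qs) {k : ℕ} (h0 : fs k 0 ≤ 0) :
    fs (k + 1) 0 ≤ 0 ∧ qs k ∈ Ioo (-1 : ℝ) 0 ∧ fs k (qs k) = qs k ∧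
      ∀ x ∈ Icc (-1 : ℝ) 0, fs (k + 1) x = x → fs k (-qs k * x) = -qs k * x := by
  obtain ⟨hu, hq0, hq1, hq2, -, hR⟩ := hs.2 k
  have hu1 := (hs.2 (k + 1)).1
  rw [hR] at hu1 ⊢
  have hq := hu.neg_of_apply_zero_nonpos (abs_pos.1 hq0) hq1 hu1 h0
  have hq1' : -1 < qs k := by rw [abs_of_neg hq] at hq1; linarith
  refine ⟨?_, ⟨hq1', hq⟩, hu.fixed_of_iterate_two_fixed h0 ⟨hq1'.le, hq.le⟩ hq2, ?_⟩
  · rw [renorm2_apply, mul_zero]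
    refine div_nonpos_of_nonneg_of_nonpos ?_ hq.le
    have := hu.le_apply_zero (x := fs k 0) ⟨hu.neg_one_le ⟨by norm_num, by norm_num⟩, by linarith⟩
    linarith
  · intro x hx hfx
    rw [renorm2_apply, div_eq_iff hq.ne] at hfx
    exact hu.fixed_of_iterate_two_fixed h0 ⟨by nlinarith [hx.1, hx.2], by nlinarith [hx.1, hx.2]⟩
      (by linarith)

theorem FeigSeq.apply_zero_pos_of_crossRatioUnimodal {f : ℝ → ℝ} {fs : ℕ → ℝ → ℝ} {qs : ℕ → ℝ}
    (hs : FeigSeq f fs qs) {k : ℕ} {t : ℝ} {h h' : ℝ → ℝ}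
    (H : CrossRatioUnimodal t (fs k) h h') : 0 < fs k 0 := by
  by_contra! h0
  obtain ⟨h1, hq, fq, hk⟩ := hs.apply_zero_nonpos_step h0
  obtain ⟨h2, hq', fq', hk'⟩ := hs.apply_zero_nonpos_step h1
  obtain ⟨-, hq'', fq'', -⟩ := hs.apply_zero_nonpos_step h2
  have e1 := hk' _ ⟨hq''.1.le, hq''.2.le⟩ fq''
  have hx : -1 < -qs (k + 1) * qs (k + 1 + 1) ∧ -qs (k + 1) * qs (k + 1 + 1) < 0 ∧
      qs (k + 1) < -qs (k + 1) * qs (k + 1 + 1) := by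
    refine ⟨?_, ?_, ?_⟩ <;> nlinarith [hq'.1, hq'.2, hq''.1, hq''.2]
  have e2 := hk _ ⟨hx.1.le, hx.2.1.le⟩ e1
  have e3 := hk _ ⟨hq'.1.le, hq'.2.le⟩ fq'
  refine H.not_four_fixedPoints_left le_rfl hq.1 ?_ ?_ ?_ H.unimodal.2.2.2.2.1 fq e3 e2
  · nlinarith [hq.1, hq.2, hq'.1, hq'.2]
  · exact mul_lt_mul_of_pos_left hx.2.2 (by linarith [hq.2])
  · nlinarith [hq.1, hq.2, hx.2.1]

/-- The restrictive endpoint of a renormalization whose turning value is positive is the fixed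
point of the map; it is not attracting, and the renormalization has no fixed point in `(-1,0]`. -/
theorem CrossRatioUnimodal.renorm2_fixedPoint {t q : ℝ} {f h h' : ℝ → ℝ}
    (H : CrossRatioUnimodal t f h h') (hq : q ∈ Ioo (0 : ℝ) 1) (hfq : 0 ≤ f q)
    (hffq : f (f q) = q) (h0 : 0 < Renorm2 f q 0) :
    f q = q ∧ 1 ≤ powDeriv t h' q ^ 2 ∧ ∀ x ∈ Ioc (-1 : ℝ) 0, Renorm2 f q x ≠ x := by
  have hu := H.unimodal
  have hq0 := hq.1
  have hf00 : f (f 0) < 0 := by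
    rw [renorm2_apply, mul_zero] at h0
    by_contra! hc
    linarith [div_nonpos_of_nonpos_of_nonneg (neg_nonpos.2 hc) hq.1.le]
  obtain ⟨M, ⟨hqM, hM1⟩, hfM⟩ := intermediate_value_Icc' hq.2.le
    (hu.1.mono (Icc_subset_Icc (by linarith) le_rfl))
    (show (0 : ℝ) ∈ Icc (f 1) (f q) from ⟨by linarith [hu.2.2.2.2.2.1], hfq⟩)
  have hM0 : 0 < M := hq.1.trans_le hqM
  have hI : ∀ x ∈ Icc 0 M, x ∈ Icc (0 : ℝ) 1 := fun x hx => ⟨hx.1, hx.2.trans hM1⟩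
  have hmap : ∀ x ∈ Icc 0 M, f x ∈ Icc (0 : ℝ) 1 := fun x hx =>
    ⟨hfM.symm.le.trans (hu.2.2.1.antitoneOn (hI x hx) ⟨hM0.le, hM1⟩ hx.2),
      (hu.le_apply_zero ⟨by linarith [hx.1], (hI x hx).2⟩).trans hu.apply_zero_le_one⟩
  have hd : ∀ x ∈ Icc 0 M, HasDerivWithinAt (fun x => f (f x))
      (powDeriv t h' (f x) * powDeriv t h' x) (Icc 0 M) x := fun x hx =>
    (H.hasDerivWithinAt (hmap x hx)).comp x
      ((H.hasDerivWithinAt (hI x hx)).mono fun y hy => hI y hy) hmap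
  have hcross : ∀ a ∈ Icc 0 M, ∀ b ∈ Icc 0 M, a ≠ b → f (f a) = a → f (f b) = b →
      powDeriv t h' (f a) * powDeriv t h' a * (powDeriv t h' (f b) * powDeriv t h' b) < 1 := by
    intro a ha b hb hab fa fb
    have c1 := H.powDeriv_cross_lt (hI a ha) (hI b hb) hab
    have hne : f a ≠ f b := fun h => hab (by rw [← fa, ← fb, h])
    have c2 := H.powDeriv_cross_lt (hmap a ha) (hmap b hb) hne
    rw [fa, fb] at c2
    have c3 := mul_le_mul_of_nonneg_left c1.le (mul_nonneg_of_nonpos_of_nonpos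
      (H.powDeriv_nonpos (hmap a ha)) (H.powDeriv_nonpos (hmap b hb)))
    have c4 := c3.trans_lt c2
    have h2 : 0 < (b - a) ^ 2 := by have : b - a ≠ 0 := sub_ne_zero.2 hab.symm
                                    positivity
    nlinarith
  obtain ⟨m, hm, fm, Dm, hlt⟩ := exists_first_fixedPoint hq.1.le
    (fun x hx => (hd x ⟨hx.1, hx.2.trans hqM⟩).mono
      (Icc_subset_Icc_right hqM)) hf00 hffq
  have hmM : m ∈ Icc 0 M := ⟨hm.1.le, hm.2.trans hqM⟩
  have hleast : ∀ x, 0 ≤ x → f (f x) = x → m ≤ x := by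
    intro x hx fx
    by_contra! hc
    linarith [hlt x ⟨hx, hc⟩]
  have hfmm : f m = m := by
    have hmle := hleast (f m) (hmap m hmM).1 (by rw [fm])
    have hfmM : f m ∈ Icc 0 M := by
      refine ⟨(hmap m hmM).1, ?_⟩
      by_contra! hc
      linarith [hu.2.2.1 ⟨hM0.le, hM1⟩ (hmap m hmM) hc, hm.1]
    by_contra hne
    have := hcross m hmM (f m) hfmM (Ne.symm hne) fm (by rw [fm])
    rw [fm] at this
    nlinarith
  have huniq : ∀ x ∈ Icc 0 M, f (f x) = x → x = m := by
    intro x hx fx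
    by_contra hne
    have hmx : m < x := lt_of_le_of_ne (hleast x hx.1 fx) (Ne.symm hne)
    have h1 := hu.2.2.1 (hI m hmM) (hI x hx) hmx
    have h2 := hleast (f x) (hmap x hx).1 (by rw [fx])
    linarith
  have hqm := huniq q ⟨hq.1.le, hqM⟩ hffq
  rw [← hqm] at fm Dm hfmm
  refine ⟨hfmm, by rwa [hfmm, ← sq] at Dm, ?_⟩
  intro x hx hRx
  rw [renorm2_apply, div_eq_iff hq.1.ne'] at hRx
  have h1 : 0 ≤ -q * x := by nlinarith [hx.2]
  have h2 : -q * x < q := by nlinarith [hx.1]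
  have := huniq (-q * x) ⟨h1, h2.le.trans hqM⟩ (by linarith)
  linarith

/-- If `-1` is a non-attracting fixed point of a map with no fixed point in `(-1,0]`, then the
cross-ratio inequality bounds any non-attracting fixed point away from zero. -/
theorem CrossRatioUnimodal.fixedPoint_lower_bound {t q : ℝ} {f h h' : ℝ → ℝ}
    (H : CrossRatioUnimodal t f h h') (hq : q ∈ Ioo (0 : ℝ) 1) (hfq : f q = q)
    (hD : 1 ≤ powDeriv t h' q ^ 2) (h0 : 0 < f 0) (hne : ∀ x ∈ Ioc (-1 : ℝ) 0, f x ≠ x) :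
    min (1 / 2) ((1 / (9 * t ^ 2)) ^ (1 / (t - 1))) ≤ q := by
  have ht := H.one_lt
  have hu := H.unimodal
  have hq0 := hq.1
  have hf1 : f 1 = -1 := hu.2.2.2.2.2.1
  have hgt : ∀ x ∈ Ioc (-1 : ℝ) 0, x < f x := by
    intro x hx
    by_contra! hc
    obtain ⟨y, hy, hy0⟩ := intermediate_value_Icc hx.2
      ((hu.1.mono (Icc_subset_Icc hx.1.le zero_le_one)).sub continuousOn_id)
      (show (0 : ℝ) ∈ Icc (f x - x) (f 0 - 0) from ⟨by linarith, by linarith⟩)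
    exact hne y ⟨hx.1.trans_le hy.1, hy.2⟩ (sub_eq_zero.1 hy0)
  have hD1 : powDeriv t h' 1 ≤ -1 := by
    have h1 := (H.hasDerivWithinAt (right_mem_Icc.2 zero_le_one)).mono
      (Ico_subset_Icc_self : Ico (0 : ℝ) 1 ⊆ Icc 0 1)
    rw [hasDerivWithinAt_iff_tendsto_slope' (by simp)] at h1
    have : (nhdsWithin (1 : ℝ) (Ico 0 1)).NeBot :=
      mem_closure_iff_nhdsWithin_neBot.1 (by
        rw [closure_Ico zero_ne_one]; exact right_mem_Icc.2 zero_le_one)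
    refine le_of_tendsto h1 ?_
    filter_upwards [self_mem_nhdsWithin] with x hx
    rw [slope_def_field, hf1, div_le_iff_of_neg (by linarith [hx.2])]
    have h2 := hgt (-x) ⟨by linarith [hx.2], by linarith [hx.1]⟩
    rw [hu.apply_neg ⟨by linarith [hx.1], hx.2.le⟩] at h2
    linarith
  have hqI : q ∈ Icc (0 : ℝ) 1 := ⟨hq.1.le, hq.2.le⟩
  have hDq : powDeriv t h' q ≤ -1 := by nlinarith [H.powDeriv_nonpos hqI]
  have hr : 0 < q ^ (t - 1) := Real.rpow_pos_of_pos hq.1 _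
  have hA := neg_rpow_mem ht hqI
  have h1 : (-1 : ℝ) ∈ Icc (-1 : ℝ) 0 := ⟨le_rfl, by norm_num⟩
  have hc := H.cross_le _ h1 _ hA
  have e1 := H.eq_of_nonneg (right_mem_Icc.2 zero_le_one)
  rw [Real.one_rpow, hf1] at e1
  rw [← H.eq_of_nonneg hqI, hfq, ← e1] at hc
  simp only [powDeriv, Real.one_rpow, mul_one] at hD1 hDq
  set A := h' (-1)
  set B := h' (-(q ^ t))
  by_contra! hlt
  rw [lt_min_iff] at hlt
  have hqt : q ^ t ≤ q := by
    simpa using Real.rpow_le_rpow_of_exponent_ge hq.1 hq.2.le ht.le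
  have h3 : (1 : ℝ) / 4 ≤ (-(q ^ t) - -1) ^ 2 := by nlinarith [hlt.1]
  have h4 : q ^ (t - 1) < 1 / (9 * t ^ 2) := by
    have := Real.rpow_lt_rpow hq.1.le hlt.2 (show 0 < t - 1 by linarith)
    rwa [← Real.rpow_mul (by positivity), one_div_mul_cancel (by linarith), Real.rpow_one] at this
  rw [lt_div_iff₀ (by positivity)] at h4
  have hAB : 1 ≤ A * B * (t ^ 2 * q ^ (t - 1)) := by
    nlinarith [mul_nonneg (show 0 ≤ A * t - 1 by linarith)
      (show 0 ≤ B * (t * q ^ (t - 1)) - 1 by linarith)]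
  have hAB0 : 0 ≤ A * B := mul_nonneg (H.nonneg _ h1) (H.nonneg _ hA)
  have h5 : 9 < A * B := by nlinarith
  nlinarith [hlt.1]

theorem FeigSeq.crossRatioUnimodal {f : ℝ → ℝ} {fs : ℕ → ℝ → ℝ} {qs : ℕ → ℝ}
    (hs : FeigSeq f fs qs) {t : ℝ} {h h' : ℝ → ℝ} (H : CrossRatioUnimodal t f h h') (k : ℕ) :
    (∃ h h', CrossRatioUnimodal t (fs k) h h') ∧ qs k ∈ Ioo (0 : ℝ) 1 ∧ 0 ≤ fs k (qs k) := by
  have aux : ∀ k h h', CrossRatioUnimodal t (fs k) h h' →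
      qs k ∈ Ioo (0 : ℝ) 1 ∧ 0 ≤ fs k (qs k) := by
    intro k h h' H
    obtain ⟨hu, hq0, hq1, -, -, hR⟩ := hs.2 k
    have hu1 := (hs.2 (k + 1)).1
    rw [hR] at hu1
    have h0 := hs.apply_zero_pos_of_crossRatioUnimodal H
    have hq := hu.pos_of_apply_zero_pos (abs_pos.1 hq0) hq1 hu1 h0
    have hqI : qs k ∈ Ioo (0 : ℝ) 1 := ⟨hq, by rwa [abs_of_pos hq] at hq1⟩
    exact ⟨hqI, hu.apply_nonneg_of_pos hqI hu1 h0⟩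
  suffices ∃ h h', CrossRatioUnimodal t (fs k) h h' by
    obtain ⟨h, h', H⟩ := this
    exact ⟨⟨h, h', H⟩, aux k h h' H⟩
  induction k with
  | zero => exact ⟨h, h', by rwa [hs.1]⟩
  | succ k ih =>
    obtain ⟨h, h', H⟩ := ih
    obtain ⟨hq, hfq⟩ := aux k h h' H
    have hR := (hs.2 k).2.2.2.2.2
    have hu1 := (hs.2 (k + 1)).1
    rw [hR] at hu1 ⊢
    exact H.renorm2 hq hfq hu1

/-- The `k`-th renormalization is a linear rescaling of `f ^ (2 ^ k)`. -/
theorem FeigSeq.iterate_two_pow {f : ℝ → ℝ} {fs : ℕ → ℝ → ℝ} {qs : ℕ → ℝ}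
    (hs : FeigSeq f fs qs) (k : ℕ) (x : ℝ) :
    f^[2 ^ k] ((∏ i ∈ Finset.range k, -qs i) * x) = (∏ i ∈ Finset.range k, -qs i) * fs k x := by
  induction k generalizing x with
  | zero => simp [hs.1]
  | succ k ih =>
    have hq := abs_pos.1 (hs.2 k).2.1
    rw [pow_succ, mul_two, Function.iterate_add_apply, Finset.prod_range_succ, mul_assoc, ih, ih,
      (hs.2 k).2.2.2.2.2, renorm2_apply]
    field_simp

theorem Unimodal.eq_of_fixedPoint {f : ℝ → ℝ} (hf : Unimodal f) {x y : ℝ}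
    (hx : x ∈ Icc (0 : ℝ) 1) (hy : y ∈ Icc (0 : ℝ) 1) (hfx : f x = x) (hfy : f y = y) : x = y := by
  rcases lt_trichotomy x y with h | h | h
  · linarith [hf.2.2.1 hx hy h]
  · exact h
  · linarith [hf.2.2.1 hy hx h]

/-- **Lemma 2.** There is `C₂ = C₂(f) > 0` with `|I n| / |I (n-1)| ≥ C₂` for
all `n ≥ 1`, where `I n` is the closed interval bounded by `p n` and `-p n`,
of length `2 * |p n|`. -/
theorem lemma2_In_ratio_lower_bound (f : ℝ → ℝ) (p : ℕ → ℝ)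
    (hfU : InU f) (hf : Feigenbaum f) (hp : FeigPoints f p) :
    ∃ C₂ > 0, ∀ n : ℕ, 1 ≤ n →
      C₂ ≤ (2 * |p n|) / (2 * |p (n - 1)|) := by
  obtain ⟨t, h, h', H⟩ := hfU.exists_crossRatioUnimodal
  obtain ⟨fs, qs, hs⟩ := hf
  have hV := hs.crossRatioUnimodal H
  have hfix : ∀ k, fs k (qs k) = qs k ∧ (∀ x ∈ Ioc (-1 : ℝ) 0, fs (k + 1) x ≠ x) := by
    intro k
    obtain ⟨⟨h, h', H⟩, hq, hfq⟩ := hV k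
    obtain ⟨⟨h₁, h₁', H₁⟩, -, -⟩ := hV (k + 1)
    have hpos := hs.apply_zero_pos_of_crossRatioUnimodal H₁
    obtain ⟨-, -, -, hq2, -, hR⟩ := hs.2 k
    rw [hR] at hpos ⊢
    have := H.renorm2_fixedPoint hq hfq hq2 hpos
    exact ⟨this.1, this.2.2⟩
  have hbound : ∀ k, min (1 / 2) ((1 / (9 * t ^ 2)) ^ (1 / (t - 1))) ≤ qs (k + 1) := by
    intro k
    obtain ⟨⟨h, h', H⟩, hq, hfq⟩ := hV (k + 1)
    obtain ⟨⟨h₁, h₁', H₁⟩, -, -⟩ := hV (k + 1 + 1)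
    have hpos := hs.apply_zero_pos_of_crossRatioUnimodal H₁
    obtain ⟨-, -, -, hq2, -, hR⟩ := hs.2 (k + 1)
    rw [hR] at hpos
    have := H.renorm2_fixedPoint hq hfq hq2 hpos
    exact H.fixedPoint_lower_bound hq this.1 this.2.1
      (hs.apply_zero_pos_of_crossRatioUnimodal H) (hfix k).2
  obtain ⟨hp0, hp1, hfp1, hpn⟩ := hp
  have hp1q : p 1 = qs 0 := by
    have hu := (hs.2 0).1
    have hq := (hV 0).2.1
    exact hu.eq_of_fixedPoint ⟨hp1.1.le, hp1.2.le⟩ ⟨hq.1.le, hq.2.le⟩ (by rwa [hs.1]) (hfix 0).1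
  have habs : ∀ k, |p k| = ∏ i ∈ Finset.range k, qs i := by
    intro k
    induction k with
    | zero => simp [hp0]
    | succ k ih =>
      rcases Nat.eq_zero_or_pos k with rfl | hk
      · simp [hp1q, abs_of_pos (hV 0).2.1.1]
      obtain ⟨j, rfl⟩ : ∃ j, k = j + 1 := ⟨k - 1, by omega⟩
      obtain ⟨h1, h2, h3⟩ := hpn (j + 1 + 1) (by omega)
      simp only [Nat.add_sub_cancel] at h1 h3
      have hit := hs.iterate_two_pow (j + 1)
      set P := ∏ i ∈ Finset.range (j + 1), -qs i with hP
      have hPabs : |P| = |p (j + 1)| := by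
        rw [ih, hP, Finset.abs_prod]
        exact Finset.prod_congr rfl fun i _ => by rw [abs_neg, abs_of_pos (hV i).2.1.1]
      have hP0 : P ≠ 0 := abs_pos.1 (by rw [hPabs]; linarith)
      set x := p (j + 1 + 1) / P with hx
      have hpx : p (j + 1 + 1) = P * x := by rw [hx]; field_simp
      rw [hpx, hit] at h1
      have hfx : fs (j + 1) x = x := mul_left_cancel₀ hP0 h1
      have hx1 : |x| < 1 := by
        rw [hx, abs_div, hPabs, div_lt_one (by linarith)]
        exact h3
      rw [abs_lt] at hx1
      have hx0 : 0 < x := by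
        by_contra! hc
        exact (hfix j).2 x ⟨hx1.1, hc⟩ hfx
      have hq := (hV (j + 1)).2.1
      have hxq : x = qs (j + 1) := (hs.2 (j + 1)).1.eq_of_fixedPoint ⟨hx0.le, hx1.2.le⟩
        ⟨hq.1.le, hq.2.le⟩ hfx (hfix (j + 1)).1
      rw [hpx, abs_mul, hPabs, ih, hxq, abs_of_pos hq.1, ← Finset.prod_range_succ]
  have ht : 0 < t := by linarith [H.one_lt]
  refine ⟨min (qs 0) (min (1 / 2) ((1 / (9 * t ^ 2)) ^ (1 / (t - 1)))),
    lt_min (hV 0).2.1.1 (lt_min (by norm_num) (by positivity)), ?_⟩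
  intro n hn
  obtain ⟨k, rfl⟩ : ∃ k, n = k + 1 := ⟨n - 1, by omega⟩
  have hpos : 0 < ∏ i ∈ Finset.range k, qs i := Finset.prod_pos fun i _ => (hV i).2.1.1
  rw [Nat.add_sub_cancel, habs, habs, mul_div_mul_left _ _ two_ne_zero, Finset.prod_range_succ,
    mul_div_cancel_left₀ _ hpos.ne']
  cases k with
  | zero => exact min_le_left _ _
  | succ k => exact (min_le_right _ _).trans (hbound k)
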